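/- Let X be a critical independent set in a finite simple graph G. Then X = ker(G) if and only if there is no nonempty set Y ⊆ N(X) such that |N(Y)∩X| = |Y|. -/

import Mathlib

open Finset

open scoped Classical

variable {V : Type*} [Fintype V] [DecidableEq V]

/-- The neighborhood `N(X)` of a finite set of vertices `X`. -/
noncomputable def nbr (G : SimpleGraph V) (X : Finset V) : Finset V :=
  Finset.univ.filter fun v => ∃ x ∈ X, G.Adj v x

/-- The difference `d(X) = |X| - |N(X)|` of a set of vertices. -/
noncomputable def diffZ (G : SimpleGraph V) (X : Finset V) : ℤ :=
  (X.card : ℤ) - ((nbr G X).card : ℤ)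

/-- The critical difference `d_c(G) = max {d(X) : X ⊆ V}`. -/
noncomputable def critDiff (G : SimpleGraph V) : ℤ :=
  (Finset.univ : Finset V).powerset.sup' (Finset.powerset_nonempty _) (diffZ G)

/-- A set of vertices is independent if no two of its vertices are adjacent. -/
def IsIndep (G : SimpleGraph V) (S : Finset V) : Prop :=
  ∀ u ∈ S, ∀ v ∈ S, ¬ G.Adj u v

/-- The independence number `α(G)`. -/
noncomputable def indepNum (G : SimpleGraph V) : ℕ :=
  ((Finset.univ : Finset V).powerset.filter (IsIndep G)).sup Finset.card

/-- The critical independence difference `id_c(G) = max {d(I) : I independent}`. -/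
noncomputable def idc (G : SimpleGraph V) : ℤ :=
  ((Finset.univ : Finset V).powerset.filter (IsIndep G)).sup'
    ⟨∅, by simp [IsIndep]⟩ (diffZ G)

/-- A critical independent set: an independent set `S` with `d(S) = id_c(G)`. -/
def CritIndep (G : SimpleGraph V) (S : Finset V) : Prop :=
  IsIndep G S ∧ diffZ G S = idc G

/-- A finite set of edges of `G` that are pairwise non-incident (a matching). -/
def IsMatchingSet (G : SimpleGraph V) (M : Finset (Sym2 V)) : Prop :=
  (∀ e ∈ M, e ∈ G.edgeSet) ∧
    (M : Set (Sym2 V)).Pairwise fun e f => ∀ v : V, ¬(v ∈ e ∧ v ∈ f)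

/-- The matching number `μ(G)`. -/
noncomputable def matchNum (G : SimpleGraph V) : ℕ :=
  ((Finset.univ : Finset (Sym2 V)).powerset.filter (IsMatchingSet G)).sup Finset.card

/-- A maximum independent set. -/
def IsMaxIndep (G : SimpleGraph V) (S : Finset V) : Prop :=
  IsIndep G S ∧ S.card = indepNum G

/-- `ker(G)`: the intersection of all critical independent sets. -/
noncomputable def kerSet (G : SimpleGraph V) : Finset V :=
  Finset.univ.filter fun v => ∀ S : Finset V, CritIndep G S → v ∈ S

/-- `diadem(G)`: the union of all critical independent sets. -/
noncomputable def diademSet (G : SimpleGraph V) : Finset V :=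
  Finset.univ.filter fun v => ∃ S : Finset V, CritIndep G S ∧ v ∈ S

/-- `core(G)`: the intersection of all maximum independent sets. -/
noncomputable def coreSet (G : SimpleGraph V) : Finset V :=
  Finset.univ.filter fun v => ∀ S : Finset V, IsMaxIndep G S → v ∈ S

/-- `corona(G)`: the union of all maximum independent sets. -/
noncomputable def coronaSet (G : SimpleGraph V) : Finset V :=
  Finset.univ.filter fun v => ∃ S : Finset V, IsMaxIndep G S ∧ v ∈ S

/-- `δ₀(A) = max {δ(X) : X ⊆ A}`, the maximum deficiency over subsets of a side. -/
noncomputable def delta0 (G : SimpleGraph V) (A : Finset V) : ℤ :=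
  A.powerset.sup' (Finset.powerset_nonempty _) (diffZ G)

/-- An `A`-critical set: a subset `X ⊆ A` with `δ(X) = δ₀(A)`. -/
def SideCrit (G : SimpleGraph V) (A X : Finset V) : Prop :=
  X ⊆ A ∧ diffZ G X = delta0 G A

/-- `ker_A(G)`: the intersection of all `A`-critical sets. -/
noncomputable def kerSide (G : SimpleGraph V) (A : Finset V) : Finset V :=
  Finset.univ.filter fun v => ∀ X : Finset V, SideCrit G A X → v ∈ X

/-- `diadem_A(G)`: the union of all `A`-critical sets. -/
noncomputable def diademSide (G : SimpleGraph V) (A : Finset V) : Finset V :=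
  Finset.univ.filter fun v => ∃ X : Finset V, SideCrit G A X ∧ v ∈ X

/-- `{A, B}` is a bipartition of `G`: both sides nonempty, disjoint, covering all
vertices, and every edge goes between `A` and `B`. -/
def IsBipartition (G : SimpleGraph V) (A B : Finset V) : Prop :=
  A.Nonempty ∧ B.Nonempty ∧ Disjoint A B ∧ A ∪ B = Finset.univ ∧
    ∀ u v : V, G.Adj u v → (u ∈ A ∧ v ∈ B) ∨ (u ∈ B ∧ v ∈ A)

theorem mem_nbr {G : SimpleGraph V} {X : Finset V} {v : V} :
    v ∈ nbr G X ↔ ∃ x ∈ X, G.Adj v x := by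
  simp [nbr]

theorem nbr_mono (G : SimpleGraph V) {X Y : Finset V} (h : X ⊆ Y) : nbr G X ⊆ nbr G Y := by
  intro v hv
  obtain ⟨x, hx, hvx⟩ := mem_nbr.1 hv
  exact mem_nbr.2 ⟨x, h hx, hvx⟩

theorem nbr_union (G : SimpleGraph V) (X Y : Finset V) :
    nbr G (X ∪ Y) = nbr G X ∪ nbr G Y := by
  ext v
  simp only [mem_nbr, mem_union, or_and_right, exists_or]

/-- Removing from `X` the neighbors of `Y` removes `Y` from the neighborhood of `X`. -/
theorem nbr_sdiff_nbr_subset (G : SimpleGraph V) (X Y : Finset V) :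
    nbr G (X \ nbr G Y) ⊆ nbr G X \ Y := by
  intro v hv
  obtain ⟨x, hx, hvx⟩ := mem_nbr.1 hv
  rw [mem_sdiff] at hx
  exact mem_sdiff.2 ⟨mem_nbr.2 ⟨x, hx.1, hvx⟩, fun hvY => hx.2 (mem_nbr.2 ⟨v, hvY, hvx.symm⟩)⟩

theorem diffZ_sdiff_nbr (G : SimpleGraph V) (X Y : Finset V) :
    diffZ G X + ((Y ∩ nbr G X).card : ℤ) - ((nbr G Y ∩ X).card : ℤ) ≤
      diffZ G (X \ nbr G Y) := by
  have hN := card_le_card (nbr_sdiff_nbr_subset G X Y)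
  have h₁ := card_sdiff_add_card_inter X (nbr G Y)
  have h₂ := card_sdiff_add_card_inter (nbr G X) Y
  rw [inter_comm] at h₁ h₂
  unfold diffZ
  omega

theorem IsIndep.mono {G : SimpleGraph V} {S T : Finset V} (hT : IsIndep G T) (h : S ⊆ T) :
    IsIndep G S :=
  fun u hu v hv => hT u (h hu) v (h hv)

theorem IsIndep.diffZ_le_idc {G : SimpleGraph V} {S : Finset V} (hS : IsIndep G S) :
    diffZ G S ≤ idc G :=
  le_sup' (diffZ G) (by simpa using hS)

/-- The difference of an arbitrary set is bounded by the critical independence difference. -/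
theorem diffZ_le_idc (G : SimpleGraph V) (W : Finset V) : diffZ G W ≤ idc G := by
  have hW : IsIndep G (W \ nbr G W) := by
    intro u hu v hv huv
    exact (mem_sdiff.1 hu).2 (mem_nbr.2 ⟨v, (mem_sdiff.1 hv).1, huv⟩)
  have h := diffZ_sdiff_nbr G W W
  rw [inter_comm W] at h
  linarith [hW.diffZ_le_idc]

/-- The difference function is supermodular. -/
theorem diffZ_add_le (G : SimpleGraph V) (X Y : Finset V) :
    diffZ G X + diffZ G Y ≤ diffZ G (X ∪ Y) + diffZ G (X ∩ Y) := by
  have h₁ := card_union_add_card_inter X Y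
  have h₂ := card_union_add_card_inter (nbr G X) (nbr G Y)
  have h₃ : (nbr G (X ∩ Y)).card ≤ (nbr G X ∩ nbr G Y).card :=
    card_le_card (subset_inter (nbr_mono G inter_subset_left) (nbr_mono G inter_subset_right))
  unfold diffZ
  rw [nbr_union]
  omega

theorem CritIndep.inter {G : SimpleGraph V} {X S : Finset V} (hX : CritIndep G X)
    (hS : CritIndep G S) : CritIndep G (X ∩ S) := by
  refine ⟨hX.1.mono inter_subset_left, le_antisymm (diffZ_le_idc G _) ?_⟩
  linarith [diffZ_add_le G X S, diffZ_le_idc G (X ∪ S), hX.2, hS.2]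

/-- Hall's condition for the neighborhood of a critical independent set. -/
theorem CritIndep.card_le_card_nbr_inter {G : SimpleGraph V} {X Y : Finset V}
    (hX : CritIndep G X) (hY : Y ⊆ nbr G X) : Y.card ≤ (nbr G Y ∩ X).card := by
  have h := diffZ_sdiff_nbr G X Y
  rw [inter_eq_left.2 hY, hX.2] at h
  have := diffZ_le_idc G (X \ nbr G Y)
  omega

/-- A critical independent set `X` equals `ker(G)` iff there is no nonempty
set `Y ⊆ N(X)` with `|N(Y) ∩ X| = |Y|`. -/
theorem eq_kerSet_iff_no_tight_subset (G : SimpleGraph V) (X : Finset V)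
    (hX : CritIndep G X) :
    X = kerSet G ↔
      ¬∃ Y : Finset V, Y ⊆ nbr G X ∧ Y ≠ ∅ ∧ (nbr G Y ∩ X).card = Y.card := by
  constructor
  · rintro hker ⟨Y, hYX, hY, hcard⟩
    have hcrit : CritIndep G (X \ nbr G Y) := by
      refine ⟨hX.1.mono sdiff_subset, le_antisymm (diffZ_le_idc G _) ?_⟩
      have h := diffZ_sdiff_nbr G X Y
      rw [inter_eq_left.2 hYX, hX.2, hcard] at h
      linarith
    obtain ⟨v, hv⟩ : (nbr G Y ∩ X).Nonempty := by
      rw [← card_pos, hcard, card_pos]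
      exact nonempty_iff_ne_empty.2 hY
    obtain ⟨hvY, hvX⟩ := mem_inter.1 hv
    rw [hker, kerSet, mem_filter] at hvX
    exact (mem_sdiff.1 (hvX.2 _ hcrit)).2 hvY
  · intro hno
    refine Subset.antisymm (fun v hv => ?_) (fun v hv => (mem_filter.1 hv).2 X hX)
    refine mem_filter.2 ⟨mem_univ v, fun S hS => ?_⟩
    have hd : diffZ G X = diffZ G (X ∩ S) := hX.2.trans (hX.inter hS).2.symm
    unfold diffZ at hd
    have hN := card_sdiff_add_card_eq_card (nbr_mono G (inter_subset_left : X ∩ S ⊆ X))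
    have hXS := card_sdiff_add_card_inter X S
    have hle : (nbr G (nbr G X \ nbr G (X ∩ S)) ∩ X).card ≤ (X \ S).card := by
      refine card_le_card fun x hx => ?_
      obtain ⟨hxY, hxX⟩ := mem_inter.1 hx
      obtain ⟨y, hy, hxy⟩ := mem_nbr.1 hxY
      exact mem_sdiff.2 ⟨hxX, fun hxS =>
        (mem_sdiff.1 hy).2 (mem_nbr.2 ⟨x, mem_inter.2 ⟨hxX, hxS⟩, hxy.symm⟩)⟩
    have hge := hX.card_le_card_nbr_inter (Y := nbr G X \ nbr G (X ∩ S)) sdiff_subset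
    have hempty : nbr G X \ nbr G (X ∩ S) = ∅ := by
      by_contra hne
      exact hno ⟨_, sdiff_subset, hne, by omega⟩
    rw [hempty, card_empty] at hN
    have hsd : X \ S = ∅ := card_eq_zero.1 (by omega)
    exact sdiff_eq_empty_iff_subset.1 hsd hv
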